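/- Let (v_t, b_z) be a resolvable configuration with z ≥ 2. Then for every integer k with 2 ≤ k ≤ 1 + t there exists a k-server PIR [m,v]-code with m = v + (k−1)·v/z. -/

import Mathlib

/-- `G` is the generator matrix of a `k`-server PIR `[m,s]`-code. -/
def IsPIRMatrix (s m k : ℕ) (G : Matrix (Fin s) (Fin m) (ZMod 2)) : Prop :=
  ∀ i : Fin s, ∃ R : Fin k → Finset (Fin m),
    (Pairwise fun a b => Disjoint (R a) (R b)) ∧
    ∀ a : Fin k, (∑ j ∈ R a, fun r => G r j) = Pi.single i (1 : ZMod 2)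

/-- There exists a `k`-server PIR `[m,s]`-code. -/
def ExistsPIRCode (s m k : ℕ) : Prop :=
  ∃ G : Matrix (Fin s) (Fin m) (ZMod 2), IsPIRMatrix s m k G


/-- A `(v_t, b_z)`-configuration: `v` points, `b` lines (subsets of the point set), each
line has `z` points, each point lies on `t` lines, and two distinct points lie on at most
one common line. -/
structure CombConfig (X : Type*) [DecidableEq X] [Fintype X] (v b t z : ℕ) where
  lines : Finset (Finset X)
  card_points : Fintype.card X = v
  card_lines : lines.card = b
  line_size : ∀ l ∈ lines, l.card = z
  point_degree : ∀ x : X, (lines.filter fun l => x ∈ l).card = t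
  two_points : ∀ x y : X, x ≠ y → (lines.filter fun l => x ∈ l ∧ y ∈ l).card ≤ 1

/-- A parallel class: a set of lines partitioning the point set. -/
def IsParallelClass {X : Type*} [DecidableEq X] [Fintype X]
    (lines C : Finset (Finset X)) : Prop :=
  C ⊆ lines ∧ ∀ x : X, ∃! l, l ∈ C ∧ x ∈ l

/-- A resolution: a partition of the set of lines into parallel classes. -/
def IsResolution {X : Type*} [DecidableEq X] [Fintype X]
    (lines : Finset (Finset X)) (R : Finset (Finset (Finset X))) : Prop :=
  (∀ C ∈ R, IsParallelClass lines C ∧ C.Nonempty) ∧ ∀ l ∈ lines, ∃! C, C ∈ R ∧ l ∈ C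

/-- Transfer: a PIR matrix indexed by arbitrary finite types yields a PIR code. -/
theorem existsPIRCode_of_types {S J K : Type*} [Fintype S] [DecidableEq S] [Fintype J]
    [Fintype K] (s m k : ℕ) (hS : Fintype.card S = s) (hJ : Fintype.card J = m)
    (hK : Fintype.card K = k) (G : S → J → ZMod 2)
    (h : ∀ x : S, ∃ R : K → Finset J, (∀ a b j, j ∈ R a → j ∈ R b → a = b) ∧
      ∀ a r, (∑ j ∈ R a, G r j) = if r = x then 1 else 0) : ExistsPIRCode s m k := by
  classical
  let eS := Fintype.equivFinOfCardEq hS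
  let eJ := Fintype.equivFinOfCardEq hJ
  let eK := Fintype.equivFinOfCardEq hK
  refine ⟨fun i j => G (eS.symm i) (eJ.symm j), fun i => ?_⟩
  obtain ⟨R, hR, hsum⟩ := h (eS.symm i)
  refine ⟨fun a => (R (eK.symm a)).map eJ.toEmbedding, ?_, ?_⟩
  · intro a b hab
    refine Finset.disjoint_left.2 fun j ha hb => hab ?_
    rw [Finset.mem_map_equiv] at ha hb
    exact eK.symm.injective (hR _ _ _ ha hb)
  · intro a
    funext r
    have := hsum (eK.symm a) (eS.symm r)
    rw [Finset.sum_apply, Finset.sum_map]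
    simp only [Equiv.coe_toEmbedding, Equiv.symm_apply_apply]
    rw [this, Pi.single_apply]
    simp

/-- A parallel class has `v / z` lines. -/
theorem parallelClass_card {X : Type*} [DecidableEq X] [Fintype X]
    (v b t z : ℕ) (cfg : CombConfig X v b t z) (hz : 2 ≤ z) (C : Finset (Finset X))
    (hC : IsParallelClass cfg.lines C) : C.card = v / z := by
  have h1 : C.biUnion id = Finset.univ := by
    ext x
    obtain ⟨l, hl, -⟩ := hC.2 x
    simpa using ⟨l, hl⟩
  have h2 : (C.biUnion id).card = ∑ l ∈ C, l.card := by
    refine Finset.card_biUnion ?_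
    intro l hl l' hl' hne
    refine Finset.disjoint_left.2 fun x hx hx' => hne ?_
    exact (hC.2 x).unique ⟨hl, hx⟩ ⟨hl', hx'⟩
  rw [h1, Finset.card_univ, cfg.card_points,
    Finset.sum_congr rfl (fun l hl => cfg.line_size l (hC.1 hl)), Finset.sum_const,
    smul_eq_mul] at h2
  rw [h2, Nat.mul_div_cancel _ (by omega)]

/-- A resolution has at least `t` classes. -/
theorem resolution_card {X : Type*} [DecidableEq X] [Fintype X]
    (v b t z : ℕ) (cfg : CombConfig X v b t z) (R : Finset (Finset (Finset X)))
    (hR : IsResolution cfg.lines R) (x : X) : t ≤ R.card := by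
  rw [← cfg.point_degree x]
  have h : ∀ l : Finset X, ∃ C, l ∈ cfg.lines → C ∈ R ∧ l ∈ C := by
    intro l
    by_cases hl : l ∈ cfg.lines
    · obtain ⟨C, hC, -⟩ := hR.2 l hl
      exact ⟨C, fun _ => hC⟩
    · exact ⟨∅, fun h => absurd h hl⟩
  choose c hc using h
  refine Finset.card_le_card_of_injOn c ?_ ?_
  · intro l hl
    have hl := Finset.mem_filter.1 hl
    exact (hc l hl.1).1
  · intro l hl l' hl' he
    have hl := Finset.mem_filter.1 hl
    have hl' := Finset.mem_filter.1 hl'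
    have h1 := hc l hl.1
    have h2 := hc l' hl'.1
    rw [← he] at h2
    exact ((hR.1 _ h1.1).1.2 x).unique ⟨h1.2, hl.2⟩ ⟨h2.2, hl'.2⟩

/-- Let `(v_t, b_z)` be a resolvable configuration with `z ≥ 2`. Then
for every `2 ≤ k ≤ 1 + t` there exists a `k`-server PIR `[v + (k-1)·v/z, v]`-code. -/
theorem pir_code_of_resolvable_configuration {X : Type*} [DecidableEq X] [Fintype X]
    (v b t z : ℕ) (cfg : CombConfig X v b t z) (hz : 2 ≤ z)
    (hres : ∃ R, IsResolution cfg.lines R)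
    (k : ℕ) (hk2 : 2 ≤ k) (hk : k ≤ 1 + t) :
    ExistsPIRCode v (v + (k - 1) * (v / z)) k := by
  classical
  obtain ⟨R, hR⟩ := hres
  rcases isEmpty_or_nonempty X with hX | ⟨⟨x₀⟩⟩
  · have hv : v = 0 := by rw [← cfg.card_points]; exact Fintype.card_eq_zero
    subst hv
    exact ⟨fun _ _ => 0, fun i => i.elim0⟩
  have ht := resolution_card v b t z cfg R hR x₀
  obtain ⟨f⟩ : Nonempty (Fin (k - 1) ↪ R) :=
    Function.Embedding.nonempty_of_card_le (by simp; omega)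
  have hpar : ∀ a, IsParallelClass cfg.lines (f a).1 := fun a => (hR.1 _ (f a).2).1
  refine existsPIRCode_of_types (S := X) (J := X ⊕ (Σ a : Fin (k - 1), {l // l ∈ (f a).1}))
    (K := Option (Fin (k - 1))) v _ k cfg.card_points ?_ ?_
    (fun r j => Sum.elim (fun y => if r = y then 1 else 0)
      (fun p => if r ∈ p.2.1 then 1 else 0) j) ?_
  · rw [Fintype.card_sum, Fintype.card_sigma, cfg.card_points]
    simp [Fintype.card_coe, fun a => parallelClass_card v b t z cfg hz _ (hpar a)]
  · simp; omega
  intro x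
  have hl : ∀ a, ∃ l, l ∈ (f a).1 ∧ x ∈ l := fun a => ((hpar a).2 x).exists
  choose l hlC hxl using hl
  have key : ∀ a a' y, y ≠ x → y ∈ l a → y ∈ l a' → a = a' := by
    intro a a' y hy h h'
    have he : l a = l a' := Finset.card_le_one.1 (cfg.two_points x y hy.symm) _
      (Finset.mem_filter.2 ⟨(hpar a).1 (hlC a), hxl a, h⟩) _
      (Finset.mem_filter.2 ⟨(hpar a').1 (hlC a'), hxl a', h'⟩)
    apply f.injective
    apply Subtype.ext
    exact (hR.2 _ ((hpar a).1 (hlC a))).unique ⟨(f a).2, hlC a⟩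
      ⟨(f a').2, he ▸ hlC a'⟩
  refine ⟨fun o => o.elim (Finset.disjSum {x} ∅)
    (fun a => Finset.disjSum ((l a).erase x) {⟨a, l a, hlC a⟩}), ?_, ?_⟩
  · rintro (_ | a) (_ | a') (y | p) h h'
    · rfl
    · rfl
    · simp at h h'; exact absurd h h'.1
    · simp at h
    · simp at h h'; exact absurd h' h.1
    · simp at h'
    · simp at h h'; rw [key a a' y h.1 h.2 h'.2]
    · simp at h h'
      have := congrArg Sigma.fst (h.symm.trans h')
      simpa using this
  · rintro (_ | a) r
    · simp [Finset.sum_disjSum]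
    · simp only [Option.elim_some, Finset.sum_disjSum, Sum.elim_inl, Sum.elim_inr,
        Finset.sum_singleton, Finset.sum_ite_eq, Finset.mem_erase]
      by_cases hr : r = x
      · subst hr; simp [hxl a]
      · by_cases hm : r ∈ l a
        · simp [hr, hm]; decide
        · simp [hr, hm]
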